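/- arXiv:math/0504435 — 2 statements merged into one kernel-verified Lean document; each statement's English description precedes it below -/
import Mathlib

section
/- Let p, q be free projections in a tracial W*-probability space with τ(p) = α, τ(q) = β ∈ (0,1). Then the distribution of pqp is (1−min{α,β})δ₀ + max{α+β−1,0}δ₁ + (sqrt((x−ξ)(η−x))/(2πx(1−x)))·1_{(ξ,η)}(x)dx, where ξ, η = α+β−2αβ ∓ sqrt(4αβ(1−α)(1−β)). -/
open Real MeasureTheory

/-- Shifted Chebyshev-type recursion. -/
noncomputable def chebR {A : Type*} [Ring A] (y d : A) : ℕ → A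
  | 0 => 0
  | 1 => 1
  | (n+2) => y * chebR y d (n+1) - d * chebR y d n

lemma chebR_commute {A : Type*} [Ring A] (y d a : A) (hy : Commute y a) (hd : Commute d a) (n : ℕ) :
    Commute (chebR y d n) a := by
  induction n using Nat.twoStepInduction with
  | zero => simp [chebR]
  | one => simp [chebR]
  | more n h1 h2 => 
    rw [chebR]
    exact (hy.mul_left h2).sub_left (hd.mul_left h1)

section
variable {A : Type*} [Ring A] [Algebra ℂ A]

lemma alg_y_comm (a b : A) (s t sA tB : ℂ) (ha : a * a = s • a + sA • 1) 
   (hb : b * b = t • b + tB • 1) :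
    Commute (a * b + b * a - t • a - s • b + (t * s) • (1:A)) a := by
  unfold Commute SemiconjBy
  have e1 : a * a * b = s • (a * b) + sA • b := by rw [ha]; simp [add_mul]
  have e2 : b * a * a = s • (b * a) + sA • b := by rw [mul_assoc, ha]; simp [mul_add]
  simp only [add_mul, sub_mul, mul_add, mul_sub, smul_mul_assoc, mul_smul_comm, one_mul, mul_one,
    ← mul_assoc, e1, e2, ha]
  module

lemma alg_aba (a b : A) (s t sA tB : ℂ) (ha : a * a = s • a + sA • 1) :
    a * b * a = (a * b + b * a - t • a - s • b + (t * s) • (1:A)) * a + (t * sA) • 1 - sA • b := by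
  have e2 : b * a * a = s • (b * a) + sA • b := by rw [mul_assoc, ha]; simp [mul_add]
  simp only [add_mul, sub_mul, mul_add, mul_sub, smul_mul_assoc, mul_smul_comm, one_mul, mul_one,
    ← mul_assoc, e2, ha]
  module

lemma alg_abab (a b y : A) (s t sA tB : ℂ) 
   (hb : b * b = t • b + tB • 1) (h : a * b * a = y * a + (t * sA) • 1 - sA • b) :
    (a * b) * (a * b) = y * (a * b) - algebraMap ℂ A (sA * tB) * 1 := by
  rw [← mul_assoc, h, Algebra.algebraMap_eq_smul_one]
  simp only [add_mul, sub_mul, mul_add, mul_sub, smul_mul_assoc, mul_smul_comm, one_mul, mul_one,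
    ← mul_assoc, hb]
  simp only [mul_assoc, hb]
  module

lemma alg_pow (a b y : A) (s t sA tB : ℂ) (hya : Commute y a) (hyb : Commute y b)
   (h : (a * b) * (a * b) = y * (a * b) - algebraMap ℂ A (sA * tB) * 1) (n : ℕ) :
    (a * b) ^ (n+1) = chebR y (algebraMap ℂ A (sA * tB)) (n+1) * (a * b)
      - algebraMap ℂ A (sA * tB) * chebR y (algebraMap ℂ A (sA * tB)) n := by
  set d := algebraMap ℂ A (sA * tB) with hd
  have hdc : ∀ x, d * x = x * d := fun x => Algebra.commutes _ _
  induction n with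
  | zero => simp [chebR]
  | succ n ih =>
    rw [pow_succ, ih, sub_mul, mul_assoc, h, chebR]
    have c : chebR y d (n+1) * y = y * chebR y d (n+1) := 
      chebR_commute y d y (Commute.refl _) (hdc _) _
    rw [mul_sub, ← mul_assoc, c, sub_mul, mul_one, hdc (chebR y d (n+1))]
    abel

lemma alg_powa (a b y : A) (s t sA tB : ℂ) (hya : Commute y a) (hyb : Commute y b)
   (h1 : a * b * a = y * a + (t * sA) • 1 - sA • b)
   (h : ∀ n, (a * b) ^ (n+1) = chebR y (algebraMap ℂ A (sA * tB)) (n+1) * (a * b)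
      - algebraMap ℂ A (sA * tB) * chebR y (algebraMap ℂ A (sA * tB)) n) (n : ℕ) :
    (a * b) ^ n * a = chebR y (algebraMap ℂ A (sA * tB)) (n+1) * a
      + (t * sA) • chebR y (algebraMap ℂ A (sA * tB)) n
      - sA • (chebR y (algebraMap ℂ A (sA * tB)) n * b) := by
  set d := algebraMap ℂ A (sA * tB) with hd
  have hdc : ∀ x, d * x = x * d := fun x => Algebra.commutes _ _
  rcases n with _ | n
  · simp [chebR]
  have c : chebR y d (n+1) * y = y * chebR y d (n+1) := 
      chebR_commute y d y (Commute.refl _) (hdc _) _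
  rw [h, sub_mul, mul_assoc, h1, chebR, mul_sub, mul_add, ← mul_assoc, c, sub_mul]
  simp only [mul_smul_comm, mul_one]
  abel
end

lemma words {A : Type*} [Ring A] (a b : A) (n : ℕ) :
    (List.ofFn fun i : Fin (2*n) => if (i : ℕ) % 2 = 0 then a else b).prod = (a * b)^n ∧
    (List.ofFn fun i : Fin (2*n+1) => if (i : ℕ) % 2 = 0 then a else b).prod = (a * b)^n * a := by
  have key : ∀ n, (List.ofFn fun i : Fin (n+2) => if (i : ℕ) % 2 = 0 then a else b).prod =
     a * b * (List.ofFn fun i : Fin n => if (i : ℕ) % 2 = 0 then a else b).prod := by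
    intro n
    rw [List.ofFn_succ, List.ofFn_succ]
    have : ∀ m : ℕ, (m + 1 + 1) % 2 = 0 ↔ m % 2 = 0 := by intro m; omega
    simp [mul_assoc, this]
  induction n with
  | zero => simp
  | succ n ih => 
    constructor
    · have := key (2*n)
      rw [ih.1, ← pow_succ'] at this
      exact this
    · have := key (2*n+1)
      rw [ih.2, ← mul_assoc, ← pow_succ'] at this
      exact this

lemma alg_main {A : Type*} [Ring A] [Algebra ℂ A]
    (τ : A →ₗ[ℂ] ℂ) (htr : ∀ x y : A, τ (x * y) = τ (y * x)) (h1 : τ 1 = 1)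
    (p q : A) (hp : p * p = p) (hq : q * q = q) 
    (α β : ℂ)
    (hfree : ∀ n : ℕ, 1 ≤ n →
      τ ((List.ofFn fun i : Fin n =>
          if (i : ℕ) % 2 = 0 then p - (α : ℂ) • (1 : A)
          else q - (β : ℂ) • (1 : A)).prod) = 0 ∧
      τ ((List.ofFn fun i : Fin n =>
          if (i : ℕ) % 2 = 0 then q - (β : ℂ) • (1 : A)
          else p - (α : ℂ) • (1 : A)).prod) = 0) :
    ∃ F : ℕ → ℕ → ℂ, (∀ k, F k 0 = 0) ∧ (∀ n, F 0 n = (α * β)^n - (-(α * (1-β)))^n) ∧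
      (∀ k n, F (k+1) (n+1) = F k (n+2) + (α * (1-α) * (β * (1-β))) * F k n
        + (α + β - 2 * α * β) * F k (n+1)) ∧
      ∀ k, 1 ≤ k → τ ((p * q * p)^k) = F k 1 := by
  obtain ⟨a, ha0⟩ : ∃ a, a = p - α • (1:A) := ⟨_, rfl⟩
  obtain ⟨b, hb0⟩ : ∃ b, b = q - β • (1:A) := ⟨_, rfl⟩
  rw [← ha0, ← hb0] at hfree
  obtain ⟨s, hs⟩ : ∃ s, s = 1 - 2 * α := ⟨_, rfl⟩
  obtain ⟨t, ht⟩ : ∃ t, t = 1 - 2 * β := ⟨_, rfl⟩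
  obtain ⟨sA, hsA⟩ : ∃ s, s = α * (1 - α) := ⟨_, rfl⟩
  obtain ⟨tB, htB⟩ : ∃ t, t = β * (1 - β) := ⟨_, rfl⟩
  have ha : a * a = s • a + sA • 1 := by
    rw [ha0]; simp only [mul_sub, sub_mul, hp, mul_smul_comm, smul_mul_assoc, mul_one, one_mul, hs, hsA]
    module
  have hb : b * b = t • b + tB • 1 := by
    rw [hb0]; simp only [mul_sub, sub_mul, hq, mul_smul_comm, smul_mul_assoc, mul_one, one_mul, ht, htB]
    module
  obtain ⟨y, hy⟩ : ∃ y, y = a * b + b * a - t • a - s • b + (t * s) • (1:A) := ⟨_, rfl⟩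
  have hy' : y = b * a + a * b - s • b - t • a + (s * t) • (1:A) := by
    rw [hy, mul_comm]; abel
  have hya : Commute y a := by rw [hy]; exact alg_y_comm a b s t sA tB ha hb
  have hyb : Commute y b := by rw [hy']; exact alg_y_comm b a t s tB sA hb ha
  have aba := alg_aba a b s t sA tB ha
  rw [← hy] at aba
  have bab := alg_aba b a t s tB sA hb
  rw [← hy'] at bab
  have pa := alg_pow a b y s t sA tB hya hyb (alg_abab a b y s t sA tB hb aba)
  have pb := alg_pow b a y t s tB sA hyb hya (alg_abab b a y t s tB sA ha bab)
  have qa := alg_powa a b y s t sA tB hya hyb aba pa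
  have qb := alg_powa b a y t s tB sA hyb hya bab pb
  rw [mul_comm tB sA] at pb qb
  obtain ⟨d, hd⟩ : ∃ d, d = algebraMap ℂ A (sA * tB) := ⟨_, rfl⟩
  have hdm : ∀ x, d * x = (sA * tB) • x := fun x => by rw [hd, Algebra.smul_def]
  rw [← hd] at pa pb qa qb
  have hdc : ∀ x, Commute d x := fun x => by rw [hd]; exact Algebra.commutes _ _
  obtain ⟨R, hR⟩ : ∃ R, R = chebR y d := ⟨_, rfl⟩
  have hR0 : R 0 = 0 := by rw [hR]; rfl
  have hR1 : R 1 = 1 := by rw [hR]; rfl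
  have hR2 : ∀ n, R (n+2) = y * R (n+1) - d * R n := by intro n; rw [hR]; rfl
  have hRc : ∀ n x, Commute y x → Commute (R n) x := by
    intro n x hx; rw [hR]; exact chebR_commute y d x hx (hdc x) n
  rw [← hR] at pa pb qa qb
  have r1 : ∀ n, τ (R (n+1) * a) + t * sA * τ (R n) - sA * τ (R n * b) = 0 := by
    intro n
    have := (hfree (2*n+1) (by omega)).1
    rw [(words a b n).2, qa] at this
    simpa using this
  have r2 : ∀ n, τ (R (n+1) * b) + s * tB * τ (R n) - tB * τ (R n * a) = 0 := by
    intro n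
    have := (hfree (2*n+1) (by omega)).2
    rw [(words b a n).2, qb] at this
    simpa using this
  have r3 : ∀ n, τ (R (n+2)) - sA * tB * τ (R n) + t * τ (R (n+1) * a) + s * τ (R (n+1) * b)
      - t * s * τ (R (n+1)) = 0 := by
    intro n
    have e1 := (hfree (2*(n+1)) (by omega)).1
    rw [(words a b _).1, pa] at e1
    have e2 := (hfree (2*(n+1)) (by omega)).2
    rw [(words b a _).1, pb] at e2
    have e3 : R (n+2) = R (n+1) * (a * b) + R (n+1) * (b * a) - t • (R (n+1) * a)
       - s • (R (n+1) * b) + (t*s) • R (n+1) - (sA * tB) • R n := by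
      rw [hR2, ← (hRc (n+1) y (Commute.refl _)).eq, hdm, hy]
      simp only [mul_add, mul_sub, mul_smul_comm, mul_one]
    have e4 := congrArg τ e3
    rw [hdm] at e1 e2
    simp only [map_add, map_sub, map_smul, smul_eq_mul] at e1 e2 e4
    linear_combination e4 + e1 + e2
  have closed : ∀ n, (τ (R n * a) = (α * β)^n - (-(α * (1-β)))^n - α * 
        ((α * β)^n + ((1-α)*(1-β))^n - (-(α * (1-β)))^n - (-(β * (1-α)))^n)) ∧
      (τ (R n * b) = (α * β)^n - (-(β * (1-α)))^n - β * 
        ((α * β)^n + ((1-α)*(1-β))^n - (-(α * (1-β)))^n - (-(β * (1-α)))^n)) ∧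
      (τ (R n) = (α * β)^n + ((1-α)*(1-β))^n - (-(α * (1-β)))^n - (-(β * (1-α)))^n) ∧ 
      (τ (R (n+1)) = (α * β)^(n+1) + ((1-α)*(1-β))^(n+1) - (-(α * (1-β)))^(n+1) 
         - (-(β * (1-α)))^(n+1)) := by
    intro n
    induction n with
    | zero => 
      simp [hR0, hR1, h1]; ring
    | succ n ih =>
      obtain ⟨i1, i2, i3, i4⟩ := ih
      have f1 := r1 n
      have f2 := r2 n
      have f3 := r3 n
      rw [i2, i3] at f1
      rw [i1, i3] at f2
      have g1 := eq_sub_of_add_eq (eq_of_sub_eq_zero f1)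
      have g2 := eq_sub_of_add_eq (eq_of_sub_eq_zero f2)
      rw [g1, g2, i3, i4] at f3
      refine ⟨?_, ?_, i4, ?_⟩
      · rw [g1, ht, hsA]; ring
      · rw [g2, hs, htB]; ring
      · rw [ht, hsA, hs, htB] at f3
        linear_combination f3
  have hpy : p = a + α • 1 := by rw [ha0]; abel
  have hqy : q = b + β • 1 := by rw [hb0]; abel
  obtain ⟨z, hz⟩ : ∃ z, z = 1 - p - q + p * q + q * p := ⟨_, rfl⟩
  have hzy : z = y + (α + β - 2 * α * β) • 1 := by
    rw [hz, hy, ha0, hb0]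
    simp only [mul_sub, sub_mul, mul_smul_comm, smul_mul_assoc, mul_one, one_mul, ht, hs]
    module
  have hpz : p * z = p * q * p := by
    rw [hz]; simp only [mul_sub, mul_add, mul_one, hp, ← mul_assoc]; abel
  have hzp : z * p = p * q * p := by
    rw [hz]; simp only [sub_mul, add_mul, one_mul, hp, mul_assoc]; abel
  refine ⟨fun k n => τ (p * z^k * R n), ?_, ?_, ?_, ?_⟩
  · simp [hR0]
  · intro n
    obtain ⟨i1, i2, i3, i4⟩ := closed n
    have : Commute (R n) p := by
      rw [hpy]; exact hRc n _ (hya.add_right ((Commute.one_right y).smul_right α))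
    simp only [pow_zero, mul_one]
    rw [← this.eq, hpy, mul_add, map_add, i1, mul_smul_comm, map_smul, mul_one, i3, smul_eq_mul]
    ring
  · intro k n
    have : z * R (n+1) = R (n+2) + (sA * tB) • R n + (α + β - 2 * α * β) • R (n+1) := by
      rw [hzy, hR2, hdm, add_mul, smul_mul_assoc, one_mul]; abel
    simp only [pow_succ]
    rw [mul_assoc, mul_assoc, mul_assoc, this]
    simp only [mul_add, mul_smul_comm, map_add, map_smul, smul_eq_mul, mul_assoc, hsA, htB]
  · intro k hk
    simp only [hR1, mul_one]
    congr 1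
    induction k, hk using Nat.le_induction with
    | base => simp [hpz]
    | succ k hk ih =>
      rw [pow_succ, ih, ← hzp, pow_succ, mul_assoc p]
      have : Commute z p := by rw [Commute, SemiconjBy, hpz, hzp]
      have h2 : p * (z ^ k * (z * p)) = p * p * (z^k * z) := by
        rw [← mul_assoc (z^k), ← pow_succ, (this.pow_left (k+1)).eq, mul_assoc]
      rw [h2, hp]


lemma cv (m c : ℝ) (hc : 0 < c) (f : ℝ → ℝ) :
    ∫ x in Set.Ioo (m - 2*c) (m + 2*c), f x =
      ∫ θ in Set.Ioo 0 π, (2 * c * sin θ) * f (m + 2 * c * cos θ) := by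
  have himg : (fun θ => m + 2 * c * cos θ) '' Set.Ioo 0 π = Set.Ioo (m - 2*c) (m + 2*c) := by
    ext x
    constructor
    · rintro ⟨θ, ⟨h0, h1⟩, rfl⟩
      have h2 : cos θ < 1 := by
        rw [← cos_zero]; exact cos_lt_cos_of_nonneg_of_le_pi le_rfl h1.le h0
      have h3 : -1 < cos θ := by
        rw [← cos_pi]; exact cos_lt_cos_of_nonneg_of_le_pi h0.le le_rfl h1
      constructor <;> simp only <;> nlinarith
    · rintro ⟨h0, h1⟩
      have e0 : -1 < (x - m) / (2*c) := by rw [lt_div_iff₀ (by positivity)]; linarith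
      have e1 : (x - m) / (2*c) < 1 := by rw [div_lt_iff₀ (by positivity)]; linarith
      refine ⟨arccos ((x - m) / (2 * c)), ⟨?_, ?_⟩, ?_⟩
      · rw [arccos_pos]; exact e1
      · refine lt_of_le_of_ne (arccos_le_pi _) ?_
        intro h; rw [arccos_eq_pi] at h; linarith
      · simp only
        rw [cos_arccos e0.le e1.le]; field_simp; ring
  have := integral_image_eq_integral_abs_deriv_smul (s := Set.Ioo 0 π)
    (f := fun θ => m + 2 * c * cos θ) (f' := fun θ => 2 * c * (- sin θ)) measurableSet_Ioo
    (fun θ _ => (((hasDerivAt_cos θ).const_mul (2*c)).const_add m).hasDerivWithinAt) 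
    (by
      intro x hx y hy hxy
      have : cos x = cos y := by
        have : 2 * c * cos x = 2 * c * cos y := by simpa using hxy
        exact mul_left_cancel₀ (by positivity) this
      exact injOn_cos ⟨hx.1.le, hx.2.le⟩ ⟨hy.1.le, hy.2.le⟩ this) f
  rw [himg] at this
  rw [this]
  refine setIntegral_congr_fun measurableSet_Ioo fun θ hθ => ?_
  have := sin_pos_of_mem_Ioo hθ
  simp only [smul_eq_mul]
  rw [mul_neg, abs_neg, abs_of_pos (by positivity)]

lemma sqrt_cv (m c θ : ℝ) (hc : 0 < c) (hθ : θ ∈ Set.Ioo 0 π) : 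
    √((m + 2 * c * cos θ - (m - 2 * c)) * (m + 2 * c - (m + 2 * c * cos θ))) = 2 * c * sin θ := by
  have := sin_pos_of_mem_Ioo hθ
  rw [show (m + 2 * c * cos θ - (m - 2 * c)) * (m + 2 * c - (m + 2 * c * cos θ)) =
    (2 * c * sin θ)^2 by rw [mul_pow, sin_sq]; ring]
  exact sqrt_sq (by positivity)

lemma cheb_sin (c θ : ℝ) (n : ℕ) : 
    c * sin θ * chebR (2 * c * cos θ) (c^2) n = c^n * sin (n * θ) := by
  induction n using Nat.twoStepInduction with
  | zero => simp [chebR]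
  | one => simp [chebR]
  | more n h1 h2 => 
    rw [chebR]
    push_cast at *
    have e1 : sin ((n + 2 : ℝ) * θ) = 2 * cos θ * sin ((n+1 : ℝ) * θ) - sin (n * θ) := by
      rw [show (n + 2 : ℝ) * θ = (n+1 : ℝ) * θ + θ by ring,
        show (n : ℝ) * θ = (n+1 : ℝ) * θ - θ by ring, sin_add, sin_sub]; ring
    rw [e1]
    linear_combination 2 * c * cos θ * h2 - c^2 * h1

lemma orth (m c : ℝ) (hc : 0 < c) (n : ℕ) :
    ∫ x in Set.Ioo (m - 2*c) (m + 2*c), chebR (x - m) (c^2) n * 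
      (√((x - (m - 2 * c)) * (m + 2 * c - x)) / (2 * π)) = if n = 1 then c^2 else 0 := by
  rw [cv m c hc]
  have : ∫ θ in Set.Ioo 0 π, (2 * c * sin θ) * (chebR (m + 2 * c * cos θ - m) (c^2) n * 
      (√((m + 2 * c * cos θ - (m - 2 * c)) * (m + 2 * c - (m + 2 * c * cos θ))) / (2 * π)))
     = ∫ θ in Set.Ioo 0 π, (c^(n+1) / π) * (cos ((n - 1 : ℝ) * θ) - cos ((n+1:ℝ)*θ)) := by
    refine setIntegral_congr_fun measurableSet_Ioo fun θ hθ => ?_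
    rw [sqrt_cv m c θ hc hθ, add_sub_cancel_left, sub_mul, add_mul, one_mul, cos_sub, cos_add]
    have := cheb_sin c θ n
    field_simp
    linear_combination (2 * c * sin θ) * this
  rw [this, ← integral_Ioc_eq_integral_Ioo, ← intervalIntegral.integral_of_le pi_pos.le,
    intervalIntegral.integral_const_mul, intervalIntegral.integral_sub 
     (by apply Continuous.intervalIntegrable; fun_prop) (by apply Continuous.intervalIntegrable; fun_prop)]
  have key : ∀ k : ℤ, k ≠ 0 → ∫ θ in (0:ℝ)..π, cos ((k:ℝ) * θ) = 0 := by
    intro k hk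
    rw [intervalIntegral.integral_comp_mul_left (fun x => cos x) (by exact_mod_cast hk), integral_cos]
    simp [sin_int_mul_pi]
  have k1 := key (n+1) (by omega)
  push_cast at k1
  rw [k1]
  split_ifs with h
  · subst h
    simp
    try field_simp
  · have k2 := key (n-1) (by omega)
    push_cast at k2
    rw [k2]; simp

lemma g_zero (a b : ℝ) (ha : 0 < a) (hab : a ≤ b) :
    ∫ x in Set.Ioo (a^2+b^2 - 2*(a*b)) (a^2+b^2 + 2*(a*b)),
      (√((x - (a^2+b^2 - 2 * (a*b))) * (a^2+b^2 + 2 * (a*b) - x)) / (2 * π * x)) = a^2 := by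
  have hb : 0 < b := by linarith
  rw [cv (a^2+b^2) (a*b) (by positivity)]
  have hD : ∀ θ ∈ Set.Ioo 0 π, 0 < a^2 + b^2 + 2 * (a*b) * cos θ := by
    intro θ hθ
    have h3 : -1 < cos θ := by
        rw [← cos_pi]; exact cos_lt_cos_of_nonneg_of_le_pi hθ.1.le le_rfl hθ.2
    have : 0 < a * b := by positivity
    nlinarith [sq_nonneg (a - b)]
  have : ∫ θ in Set.Ioo 0 π, (2 * (a*b) * sin θ) * 
      (√((a^2+b^2 + 2 * (a*b) * cos θ - (a^2+b^2 - 2 * (a*b))) * 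
        (a^2+b^2 + 2 * (a*b) - (a^2+b^2 + 2 * (a*b) * cos θ))) / (2 * π * 
          (a^2+b^2 + 2 * (a*b) * cos θ)))
     = ∫ θ in Set.Ioo 0 π, (1/(2*π)) * (- (b^2-a^2) * ((b^2-a^2) / (a^2 + b^2 + 2 * (a*b) * cos θ))
       + (a^2 + b^2 - 2 * (a * b) * cos θ)) := by
    refine setIntegral_congr_fun measurableSet_Ioo fun θ hθ => ?_
    have := hD θ hθ
    rw [sqrt_cv _ _ θ (by positivity) hθ]
    have h' : a^2 + b^2 + 2 * a * b * cos θ ≠ 0 := by rw [mul_assoc 2]; exact this.ne'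
    have h'' : a^2 + b^2 + a * 2 * b * cos θ ≠ 0 := by rw [mul_comm a 2]; exact h'
    have h3' : a^2 + b * (b + a * 2 * cos θ) ≠ 0 := by convert h' using 1; ring
    have h4' : a * (a + b * 2 * cos θ) + b^2 ≠ 0 := by convert h' using 1; ring
    field_simp
    rw [sin_sq]; ring
  rw [this, ← integral_Ioc_eq_integral_Ioo, ← intervalIntegral.integral_of_le pi_pos.le,
    intervalIntegral.integral_const_mul]
  have fin : ∫ θ in (0:ℝ)..π, (- (b^2-a^2) * ((b^2-a^2) / (a^2 + b^2 + 2 * (a*b) * cos θ))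
       + (a^2 + b^2 - 2 * (a * b) * cos θ)) = 2 * π * a^2 := by
    rcases hab.eq_or_lt with rfl | hlt
    · simp only [sub_self, neg_zero, zero_mul, zero_add]
      rw [intervalIntegral.integral_sub (by simp) (by apply Continuous.intervalIntegrable; fun_prop),
       intervalIntegral.integral_const_mul, integral_cos]
      simp; ring
    · have hD' : ∀ θ, 0 < a^2 + b^2 + 2 * (a*b) * cos θ := by
        intro θ
        have : 0 < a * b := by positivity
        nlinarith [neg_one_le_cos θ, pow_pos (sub_pos.2 hlt) 2]
      have hE : ∀ θ, 0 < b + a * cos θ := by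
        intro θ
        nlinarith [neg_one_le_cos θ]
      have := intervalIntegral.integral_eq_sub_of_hasDerivAt (a := 0) (b := π)
        (f := fun θ => - (b^2-a^2) * (θ - 2 * arctan (a * sin θ / (b + a * cos θ))) 
          + ((a^2+b^2) * θ - 2 * (a*b) * sin θ)) 
        (f' := fun θ => (- (b^2-a^2) * ((b^2-a^2) / (a^2 + b^2 + 2 * (a*b) * cos θ))
       + (a^2 + b^2 - 2 * (a * b) * cos θ))) (by
          intro θ _
          have d1 : HasDerivAt (fun θ => a * sin θ / (b + a * cos θ)) _ θ :=
            ((hasDerivAt_sin θ).const_mul a).div (((hasDerivAt_cos θ).const_mul a).const_add b)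
              (hE θ).ne'
          have d2 := (((hasDerivAt_id θ).sub (d1.arctan.const_mul 2)).const_mul (-(b^2-a^2))).add
            (((hasDerivAt_id θ).const_mul (a^2+b^2)).sub ((hasDerivAt_sin θ).const_mul (2*(a*b))))
          refine d2.congr_deriv ?_
          have h1 := hD' θ
          have h2 := hE θ
          have h3 : 1 + (a * sin θ / (b + a * cos θ))^2 = (a^2 + b^2 + 2 * (a*b) * cos θ) / (b + a * cos θ)^2 := by
            field_simp
            rw [sin_sq]; ring
          rw [h3]
          obtain ⟨D, hDD⟩ : ∃ D, D = a^2 + b^2 + 2 * (a*b) * cos θ := ⟨_, rfl⟩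
          have h5 : a * cos θ * (b + a * cos θ) - a * sin θ * (a * -sin θ) = a * b * cos θ + a^2 := by
            linear_combination a^2 * sin_sq_add_cos_sq θ
          rw [h5, ← hDD]
          rw [← hDD] at h1
          obtain ⟨E, hEE⟩ : ∃ E, E = b + a * cos θ := ⟨_, rfl⟩
          rw [← hEE] at h2 ⊢
          field_simp
          rw [hDD]
          ring) (by
          apply Continuous.intervalIntegrable
          have := fun θ => (hD' θ).ne'
          fun_prop (disch := assumption))
      rw [this]
      simp
      ring
  rw [fin]
  field_simp

lemma cheb_cont (m d : ℝ) (n : ℕ) : Continuous fun x : ℝ => chebR (x - m) d n := by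
  induction n using Nat.twoStepInduction with
  | zero => simp only [chebR]; fun_prop
  | one => simp only [chebR]; fun_prop
  | more n h1 h2 => simp only [chebR]; fun_prop

lemma cheb_neg (y d : ℝ) (n : ℕ) : chebR (-y) d n = - (-1)^n * chebR y d n := by
  induction n using Nat.twoStepInduction with
  | zero => simp [chebR]
  | one => simp [chebR]
  | more n h1 h2 => simp only [chebR, h1, h2]; ring

lemma intOn_mul (f w : ℝ → ℝ) (s t : ℝ) (hf : Continuous f) (hw : IntegrableOn w (Set.Ioo s t)) :
    IntegrableOn (fun x => f x * w x) (Set.Ioo s t) := by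
  rw [← integrableOn_Icc_iff_integrableOn_Ioo] at *
  exact hw.continuousOn_mul hf.continuousOn isCompact_Icc

lemma add3 (f g h w : ℝ → ℝ) (s t c m : ℝ) (hf : Continuous f) (hg : Continuous g) 
    (hh : Continuous h) (hw : IntegrableOn w (Set.Ioo s t)) :
    (∫ x in Set.Ioo s t, f x * w x) + c * (∫ x in Set.Ioo s t, g x * w x) 
      + m * (∫ x in Set.Ioo s t, h x * w x) = 
    ∫ x in Set.Ioo s t, (f x + c * g x + m * h x) * w x := by
  rw [← integral_const_mul, ← integral_const_mul]
  have i1 := intOn_mul f w s t hf hw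
  have i2 := (intOn_mul g w s t hg hw).const_mul c
  have i3 := (intOn_mul h w s t hh hw).const_mul m
  rw [← integral_add i1 i2]
  have i4 : IntegrableOn (fun x => f x * w x + c * (g x * w x)) (Set.Ioo s t) := i1.add i2
  rw [← integral_add i4 i3]
  refine setIntegral_congr_fun measurableSet_Ioo fun x hx => ?_
  ring

lemma g_int (a b : ℝ) (ha : 0 < a) (hab : a ≤ b) :
    IntegrableOn (fun x => (√((x - (a^2+b^2 - 2 * (a*b))) * (a^2+b^2 + 2 * (a*b) - x)) / (2 * π * x)))
     (Set.Ioo (a^2+b^2 - 2*(a*b)) (a^2+b^2 + 2*(a*b))) := by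
  apply Integrable.of_integral_ne_zero
  rw [g_zero a b ha hab]
  positivity

lemma g_n (a b : ℝ) (ha : 0 < a) (hab : a ≤ b) (n : ℕ) :
    ∫ x in Set.Ioo (a^2+b^2 - 2*(a*b)) (a^2+b^2 + 2*(a*b)), chebR (x - (a^2+b^2)) ((a*b)^2) (n+1) * 
      (√((x - (a^2+b^2 - 2 * (a*b))) * (a^2+b^2 + 2 * (a*b) - x)) / (2 * π * x)) = -(-a^2)^(n+1) := by
  have hb : 0 < b := by linarith
  set m := a^2+b^2 with hm
  set c := a * b with hc
  have hc0 : 0 < c := by positivity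
  have hge : 0 ≤ m - 2 * c := by rw [hm, hc]; nlinarith [sq_nonneg (a-b)]
  set w : ℝ → ℝ := fun x => √((x - (m - 2 * c)) * (m + 2 * c - x)) / (2 * π * x) with hw
  have hwi : IntegrableOn w (Set.Ioo (m - 2*c) (m + 2*c)) := g_int a b ha hab
  obtain ⟨G, hG⟩ : ∃ G : ℕ → ℝ, ∀ n, G n = ∫ x in Set.Ioo (m - 2*c) (m + 2*c), 
    chebR (x - m) (c^2) n * w x := ⟨_, fun n => rfl⟩
  have hi : ∀ n, IntegrableOn (fun x => chebR (x - m) (c^2) n * w x) (Set.Ioo (m - 2*c) (m + 2*c)) :=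
    fun n => intOn_mul _ _ _ _ (cheb_cont m _ n) hwi
  have G0 : G 0 = 0 := by rw [hG]; simp [chebR]
  have G1 : G 1 = a^2 := by rw [hG]; simp only [chebR, one_mul]; exact g_zero a b ha hab
  have hrec : ∀ n, G (n+2) + c^2 * G n + m * G (n+1) = if n = 0 then c^2 else 0 := by
    intro n
    have o := orth m c hc0 (n+1)
    simp only [Nat.add_eq_right] at o
    rw [← o, hG, hG, hG, add3 _ _ _ _ _ _ _ _ (cheb_cont m _ _) (cheb_cont m _ _) (cheb_cont m _ _) hwi]
    refine setIntegral_congr_fun measurableSet_Ioo fun x hx => ?_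
    have hx0 : 0 < x := lt_of_le_of_lt hge hx.1
    simp only [chebR, hw]
    field_simp
    ring
  change ∫ x in Set.Ioo (m - 2*c) (m + 2*c), chebR (x - m) (c^2) (n+1) * w x = _
  rw [← hG]
  induction n using Nat.twoStepInduction with
  | zero => rw [G1]; ring
  | one => 
    have := hrec 0
    simp only [zero_add, G0, G1, if_true] at this
    rw [hm, hc] at this
    linear_combination this
  | more n h1 h2 =>
    have := hrec (n+1)
    simp only [Nat.add_eq_zero_iff, one_ne_zero, and_false, if_false] at this
    rw [h1] at this
    rw [show n + 1 + 1 = n + 2 by ring] at this h2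
    rw [h2, hm, hc] at this
    rw [show n + 1 + 2 = n + 2 + 1 by ring] at this
    linear_combination this

lemma h_int_n (a b m : ℝ) (ha : 0 < a) (hab : a ≤ b) (hm : m = 1 - (a^2 + b^2)) (n : ℕ) :
    IntegrableOn (fun x => √((x - (m - 2 * (a*b))) * (m + 2 * (a*b) - x)) / (2 * π * (1 - x))) 
      (Set.Ioo (m - 2*(a*b)) (m + 2*(a*b))) ∧
    ∫ x in Set.Ioo (m - 2*(a*b)) (m + 2*(a*b)), chebR (x - m) ((a*b)^2) (n+1) * 
      (√((x - (m - 2 * (a*b))) * (m + 2 * (a*b) - x)) / (2 * π * (1 - x))) = (a^2)^(n+1) := by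
  have key : ∀ f : ℝ → ℝ, ∀ x, (Set.Ioo (a^2+b^2 - 2*(a*b)) (a^2+b^2 + 2*(a*b))).indicator f (1 - x) =
      (Set.Ioo (m - 2*(a*b)) (m + 2*(a*b))).indicator (fun x => f (1 - x)) x := by
    intro f x
    by_cases h : x ∈ Set.Ioo (m - 2*(a*b)) (m + 2*(a*b))
    · rw [Set.indicator_of_mem h, Set.indicator_of_mem]
      constructor <;> linarith [h.1, h.2]
    · rw [Set.indicator_of_notMem h, Set.indicator_of_notMem]
      intro h'
      exact h ⟨by linarith [h'.2], by linarith [h'.1]⟩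
  have hs : ∀ x, √((1 - x - (a^2+b^2 - 2 * (a*b))) * (a^2+b^2 + 2 * (a*b) - (1 - x))) =
    √((x - (m - 2 * (a*b))) * (m + 2 * (a*b) - x)) := by
    intro x; rw [hm]; congr 1; ring
  constructor
  · have h := g_int a b ha hab
    rw [← integrable_indicator_iff measurableSet_Ioo] at h ⊢
    have h2 := h.comp_sub_left 1
    simp only [key, hs] at h2
    exact h2
  · have h := g_n a b ha hab n
    rw [← integral_indicator measurableSet_Ioo, ← integral_sub_left_eq_self _ volume 1] at h
    simp only [key, hs] at h
    rw [integral_indicator measurableSet_Ioo] at h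
    have e : ∀ x, chebR (1 - x - (a^2+b^2)) ((a*b)^2) (n+1) = -(-1)^(n+1) * chebR (x - m) ((a*b)^2) (n+1) := by
      intro x
      rw [← cheb_neg]; congr 1; rw [hm]; ring
    simp only [e, mul_assoc] at h
    rw [integral_const_mul] at h
    have e2 : (-a^2)^(n+1) = (-1)^(n+1) * (a^2)^(n+1) := by rw [← mul_pow]; ring
    rw [e2] at h
    have e3 : ((-1:ℝ)^(n+1)) ≠ 0 := by simp
    apply mul_left_cancel₀ e3
    simp only [mul_assoc] at h ⊢
    linarith

lemma tot (a b a' b' m : ℝ) (ha : 0 < a) (hab : a ≤ b) (ha' : 0 < a') (hab' : a' ≤ b') 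
    (hm : m = a^2 + b^2) (hm' : m = 1 - (a'^2 + b'^2)) (hc : a * b = a' * b') :
    Set.Ioo (m - 2*(a*b)) (m + 2*(a*b)) ⊆ Set.Ioo 0 1 ∧
    IntegrableOn (fun x => √((x - (m - 2 * (a*b))) * (m + 2 * (a*b) - x)) / (2 * π * x * (1 - x))) 
      (Set.Ioo (m - 2*(a*b)) (m + 2*(a*b))) ∧
    ∀ n, ∫ x in Set.Ioo (m - 2*(a*b)) (m + 2*(a*b)), chebR (x - m) ((a*b)^2) n * 
      (√((x - (m - 2 * (a*b))) * (m + 2 * (a*b) - x)) / (2 * π * x * (1 - x))) = 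
        (a'^2)^n - (-a^2)^n := by
  have hsub : Set.Ioo (m - 2*(a*b)) (m + 2*(a*b)) ⊆ Set.Ioo 0 1 := by
    rintro x ⟨h1, h2⟩
    constructor
    · nlinarith [sq_nonneg (a-b)]
    · nlinarith [sq_nonneg (a'-b')]
  have hw : ∀ x ∈ Set.Ioo (m - 2*(a*b)) (m + 2*(a*b)), 
      √((x - (m - 2 * (a*b))) * (m + 2 * (a*b) - x)) / (2 * π * x) + 
      √((x - (m - 2 * (a*b))) * (m + 2 * (a*b) - x)) / (2 * π * (1 - x)) =
      √((x - (m - 2 * (a*b))) * (m + 2 * (a*b) - x)) / (2 * π * x * (1 - x)) := by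
    intro x hx
    have h1 := (hsub hx).1
    have h2 : 0 < 1 - x := by linarith [(hsub hx).2]
    field_simp
    ring
  have i1 := g_int a b ha hab
  have i2 := (h_int_n a' b' m ha' hab' hm' 0).1
  rw [← hm] at i1
  rw [← hc] at i2
  refine ⟨hsub, ?_, ?_⟩
  · exact IntegrableOn.congr_fun (i1.add i2) hw measurableSet_Ioo
  · intro n
    rcases n with _ | n
    · simp [chebR]
    have v1 := g_n a b ha hab n
    rw [← hm] at v1
    have v2 := (h_int_n a' b' m ha' hab' hm' n).2
    rw [← hc] at v2
    rw [sub_eq_add_neg ((a'^2)^(n+1)), ← v1, ← v2, ← integral_add (intOn_mul _ _ _ _ (cheb_cont m _ _) i2)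
      (intOn_mul _ _ _ _ (cheb_cont m _ _) i1)]
    refine setIntegral_congr_fun measurableSet_Ioo fun x hx => ?_
    rw [← hw x hx]; ring

lemma cheb_diff (x y : ℝ) (n : ℕ) : (x - y) * chebR (x + y) (x * y) n = x^n - y^n := by
  induction n using Nat.twoStepInduction with
  | zero => simp [chebR]
  | one => simp [chebR]
  | more n h1 h2 => 
    rw [chebR]
    linear_combination (x + y) * h2 - x * y * h1

lemma an_main (α β : ℝ) (hα : α ∈ Set.Ioo (0 : ℝ) 1) (hβ : β ∈ Set.Ioo (0 : ℝ) 1) (m s : ℝ)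
    (hm : m = α + β - 2 * α * β) (hs : s = √(4 * α * β * (1 - α) * (1 - β))) :
    Set.Ioo (m - s) (m + s) ⊆ Set.Ioo 0 1 ∧
    IntegrableOn (fun x => √((x - (m - s)) * (m + s - x)) / (2 * π * x * (1 - x))) 
      (Set.Ioo (m - s) (m + s)) ∧
    ∀ n, (α - min α β) * chebR (0 - m) (α * (1-α) * (β * (1-β))) n + 
      max (α + β - 1) 0 * chebR (1 - m) (α * (1-α) * (β * (1-β))) n + 
     ∫ x in Set.Ioo (m - s) (m + s), chebR (x - m) (α * (1-α) * (β * (1-β))) n * 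
      (√((x - (m - s)) * (m + s - x)) / (2 * π * x * (1 - x))) = 
        (α*β)^n - (-(α * (1-β)))^n := by
  obtain ⟨hα0, hα1⟩ := hα
  obtain ⟨hβ0, hβ1⟩ := hβ
  have hα2 : 0 < 1 - α := by linarith
  have hβ2 : 0 < 1 - β := by linarith
  have A : ∃ a b : ℝ, 0 < a ∧ a ≤ b ∧ m = a^2 + b^2 ∧ (a*b)^2 = α * (1-α) * (β * (1-β)) ∧
      ∀ n, (α - min α β) * chebR (0 - m) (α * (1-α) * (β * (1-β))) n - (-a^2)^n = -(-(α * (1-β)))^n := by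
    have hu : 0 < α * (1 - β) := by positivity
    have hv : 0 < β * (1 - α) := by positivity
    rcases le_total α β with h | h
    · refine ⟨√(α * (1-β)), √(β * (1-α)), by positivity, sqrt_le_sqrt (by nlinarith), ?_, ?_, ?_⟩
      · rw [sq_sqrt hu.le, sq_sqrt hv.le, hm]; ring
      · rw [mul_pow, sq_sqrt hu.le, sq_sqrt hv.le]; ring
      · intro n; rw [sq_sqrt hu.le, min_eq_left h]; ring
    · refine ⟨√(β * (1-α)), √(α * (1-β)), by positivity, sqrt_le_sqrt (by nlinarith), ?_, ?_, ?_⟩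
      · rw [sq_sqrt hu.le, sq_sqrt hv.le, hm]; ring
      · rw [mul_pow, sq_sqrt hu.le, sq_sqrt hv.le]; ring
      · intro n; rw [sq_sqrt hv.le, min_eq_right h]
        have := cheb_diff (-(β * (1-α))) (-(α * (1-β))) n
        rw [show -(β * (1-α)) + (-(α * (1-β))) = 0 - m by rw [hm]; ring,
          show -(β * (1-α)) * (-(α * (1-β))) = α * (1-α) * (β * (1-β)) by ring,
          show -(β * (1-α)) - (-(α * (1-β))) = α - β by ring] at this
        linear_combination this
  have B : ∃ a b : ℝ, 0 < a ∧ a ≤ b ∧ m = 1 - (a^2 + b^2) ∧ (a*b)^2 = α * (1-α) * (β * (1-β)) ∧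
      ∀ n, max (α + β - 1) 0 * chebR (1 - m) (α * (1-α) * (β * (1-β))) n + (a^2)^n = (α * β)^n := by
    have hu : 0 < α * β := by positivity
    have hv : 0 < (1 - α) * (1 - β) := by positivity
    rcases le_total (α + β - 1) 0 with h | h
    · refine ⟨√(α * β), √((1-α) * (1-β)), by positivity, sqrt_le_sqrt (by nlinarith), ?_, ?_, ?_⟩
      · rw [sq_sqrt hu.le, sq_sqrt hv.le, hm]; ring
      · rw [mul_pow, sq_sqrt hu.le, sq_sqrt hv.le]; ring
      · intro n; rw [sq_sqrt hu.le, max_eq_right h]; ring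
    · refine ⟨√((1-α) * (1-β)), √(α * β), by positivity, sqrt_le_sqrt (by nlinarith), ?_, ?_, ?_⟩
      · rw [sq_sqrt hu.le, sq_sqrt hv.le, hm]; ring
      · rw [mul_pow, sq_sqrt hu.le, sq_sqrt hv.le]; ring
      · intro n; rw [sq_sqrt hv.le, max_eq_left h]
        have := cheb_diff (α * β) ((1-α) * (1-β)) n
        rw [show α * β + (1-α) * (1-β) = 1 - m by rw [hm]; ring,
          show α * β * ((1-α) * (1-β)) = α * (1-α) * (β * (1-β)) by ring,
          show α * β - (1-α) * (1-β) = α + β - 1 by ring] at this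
        linear_combination this
  obtain ⟨a, b, ha, hab, hm1, hc1, f1⟩ := A
  obtain ⟨a', b', ha', hab', hm2, hc2, f2⟩ := B
  have hb : 0 < b := by linarith
  have hb' : 0 < b' := by linarith
  have hcc : a * b = a' * b' := by
    rw [← sq_eq_sq₀ (by positivity) (by positivity), hc1, hc2]
  have hss : s = 2 * (a * b) := by
    rw [hs, show 4 * α * β * (1 - α) * (1 - β) = (2 * (a*b))^2 by rw [mul_pow, hc1]; ring]
    exact sqrt_sq (by positivity)
  obtain ⟨t1, t2, t3⟩ := tot a b a' b' m ha hab ha' hab' hm1 hm2 hcc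
  rw [hss]
  refine ⟨t1, t2, fun n => ?_⟩
  have := t3 n
  rw [hc1] at this
  rw [this]
  linear_combination f1 n + f2 n

lemma uniq (F G : ℕ → ℕ → ℂ) (c m : ℂ) (hF : ∀ k, F k 0 = 0) (hG : ∀ k, G k 0 = 0)
    (h0 : ∀ n, F 0 n = G 0 n) 
    (rF : ∀ k n, F (k+1) (n+1) = F k (n+2) + c * F k n + m * F k (n+1))
    (rG : ∀ k n, G (k+1) (n+1) = G k (n+2) + c * G k n + m * G k (n+1)) (k n : ℕ) : F k n = G k n := by
  induction k generalizing n with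
  | zero => exact h0 n
  | succ k ih =>
    rcases n with _ | n
    · rw [hF, hG]
    · rw [rF, rG, ih, ih, ih]

lemma meas_int (c0 c1 : ℝ) (h0 : 0 ≤ c0) (h1 : 0 ≤ c1) (s t : ℝ) (w : ℝ → ℝ) 
    (hsub : Set.Ioo s t ⊆ Set.Ioo 0 1) (hwm : Measurable w)
    (hw0 : ∀ x ∈ Set.Ioo s t, 0 ≤ w x) (hwi : IntegrableOn w (Set.Ioo s t)) (k : ℕ) :
    ∫ x, x ^ k ∂((ENNReal.ofReal c0) • Measure.dirac (0 : ℝ)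
            + (ENNReal.ofReal c1) • Measure.dirac (1 : ℝ)
            + volume.withDensity fun x => ENNReal.ofReal (Set.indicator (Set.Ioo s t) w x)) =
     c0 * 0^k + c1 + ∫ x in Set.Ioo s t, x^k * w x := by
  have hd : ∀ x, ENNReal.ofReal (Set.indicator (Set.Ioo s t) w x) < ⊤ := fun x => ENNReal.ofReal_lt_top
  have hind : ∀ x, (ENNReal.ofReal (Set.indicator (Set.Ioo s t) w x)).toReal = Set.indicator (Set.Ioo s t) w x :=
    fun x => ENNReal.toReal_ofReal (Set.indicator_nonneg hw0 x)
  have hmeas : Measurable fun x => ENNReal.ofReal (Set.indicator (Set.Ioo s t) w x) :=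
    (hwm.indicator measurableSet_Ioo).ennreal_ofReal
  have e : ∀ x : ℝ, Set.indicator (Set.Ioo s t) w x * x^k = Set.indicator (Set.Ioo s t) (fun x => x^k * w x) x := by
    intro x
    by_cases h : x ∈ Set.Ioo s t <;> simp [h, mul_comm]
  have i0 : ∀ (c x : ℝ), Integrable (fun x : ℝ => x^k) (ENNReal.ofReal c • Measure.dirac x) := by
    intro c x
    exact (integrable_dirac (by simp)).smul_measure ENNReal.ofReal_ne_top
  have i2 : Integrable (fun x : ℝ => x^k) (volume.withDensity fun x => ENNReal.ofReal (Set.indicator (Set.Ioo s t) w x)) := by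
    rw [integrable_withDensity_iff_integrable_smul' hmeas (Filter.Eventually.of_forall hd)]
    simp only [hind, smul_eq_mul, e]
    rw [integrable_indicator_iff measurableSet_Ioo]
    exact intOn_mul _ _ _ _ (by fun_prop) hwi
  rw [integral_add_measure ((i0 _ _).add_measure (i0 _ _)) i2, integral_add_measure (i0 _ _) (i0 _ _),
    integral_smul_measure, integral_smul_measure, integral_dirac, integral_dirac,
    integral_withDensity_eq_integral_toReal_smul hmeas (Filter.Eventually.of_forall hd)]
  simp only [hind, smul_eq_mul, e, ENNReal.toReal_ofReal h0, ENNReal.toReal_ofReal h1]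
  rw [integral_indicator measurableSet_Ioo]
  simp


/-- For free projections `p, q` with traces `α, β ∈ (0,1)` in a tracial
W*-probability space, the distribution of `pqp` is
`(1−min{α,β})δ₀ + max{α+β−1,0}δ₁ + √((x−ξ)(η−x))/(2πx(1−x))·1_{(ξ,η)}(x) dx`.
Freeness of the pair of projections is expressed by the vanishing of the trace on
all alternating words in the centered elements `p − α·1` and `q − β·1`. -/
theorem stmt12 {A : Type*} [Ring A] [StarRing A] [Algebra ℂ A]
    (τ : A →ₗ[ℂ] ℂ) (htr : ∀ x y : A, τ (x * y) = τ (y * x)) (h1 : τ 1 = 1)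
    (hpos : ∀ x : A, 0 ≤ (τ (star x * x)).re ∧ (τ (star x * x)).im = 0)
    (p q : A) (hp : p * p = p) (hp' : star p = p) (hq : q * q = q) (hq' : star q = q)
    (α β : ℝ) (hα : α ∈ Set.Ioo (0 : ℝ) 1) (hβ : β ∈ Set.Ioo (0 : ℝ) 1)
    (hτp : τ p = (α : ℂ)) (hτq : τ q = (β : ℂ))
    (hfree : ∀ n : ℕ, 1 ≤ n →
      τ ((List.ofFn fun i : Fin n =>
          if (i : ℕ) % 2 = 0 then p - (α : ℂ) • (1 : A)
          else q - (β : ℂ) • (1 : A)).prod) = 0 ∧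
      τ ((List.ofFn fun i : Fin n =>
          if (i : ℕ) % 2 = 0 then q - (β : ℂ) • (1 : A)
          else p - (α : ℂ) • (1 : A)).prod) = 0) :
    ∀ k : ℕ, 1 ≤ k →
      τ ((p * q * p) ^ k) =
        ((∫ x, x ^ k ∂(
          (ENNReal.ofReal (1 - min α β)) • Measure.dirac (0 : ℝ)
            + (ENNReal.ofReal (max (α + β - 1) 0)) • Measure.dirac (1 : ℝ)
            + volume.withDensity fun x => ENNReal.ofReal
                (Set.indicator
                  (Set.Ioo (α + β - 2 * α * β - Real.sqrt (4 * α * β * (1 - α) * (1 - β)))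
                    (α + β - 2 * α * β + Real.sqrt (4 * α * β * (1 - α) * (1 - β))))
                  (fun x =>
                    Real.sqrt ((x - (α + β - 2 * α * β
                        - Real.sqrt (4 * α * β * (1 - α) * (1 - β))))
                      * ((α + β - 2 * α * β
                        + Real.sqrt (4 * α * β * (1 - α) * (1 - β))) - x))
                      / (2 * Real.pi * x * (1 - x))) x)) : ℝ) : ℂ) := by
  intro k hk
  obtain ⟨F, F0, F1, F2, F3⟩ := alg_main τ htr h1 p q hp hq (α : ℂ) (β : ℂ) hfree
  obtain ⟨m, hm⟩ : ∃ m, m = α + β - 2 * α * β := ⟨_, rfl⟩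
  obtain ⟨s, hs⟩ : ∃ s, s = √(4 * α * β * (1 - α) * (1 - β)) := ⟨_, rfl⟩
  rw [← hm, ← hs]
  obtain ⟨hsub, hwi, htot⟩ := an_main α β hα hβ m s hm hs
  obtain ⟨d, hd⟩ : ∃ d, d = α * (1-α) * (β * (1-β)) := ⟨_, rfl⟩
  rw [← hd] at htot
  obtain ⟨w, hw⟩ : ∃ w : ℝ → ℝ, w = fun x => √((x - (m - s)) * (m + s - x)) / (2 * π * x * (1 - x)) :=
    ⟨_, rfl⟩
  rw [← hw] at hwi
  have htot' : ∀ n, (α - min α β) * chebR (0 - m) d n + max (α + β - 1) 0 * chebR (1 - m) d n + 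
     ∫ x in Set.Ioo (m - s) (m + s), chebR (x - m) d n * w x = (α*β)^n - (-(α * (1-β)))^n := by
    intro n; rw [← htot n, hw]
  rw [← hw, meas_int (1 - min α β) (max (α + β - 1) 0) 
    (by have := min_le_left α β; linarith [hα.2]) (le_max_right _ _) (m - s) (m + s) w hsub
    (by rw [hw]; fun_prop) (by
      intro x hx
      have h := hsub hx
      have h2 : 0 < 1 - x := by linarith [h.2]
      have h3 := h.1
      rw [hw]
      positivity) hwi k, F3 k hk]
  obtain ⟨G, hG⟩ : ∃ G : ℕ → ℕ → ℝ, ∀ k n, G k n = (α - min α β) * 0^k * chebR (0 - m) d n + 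
     max (α + β - 1) 0 * chebR (1 - m) d n + 
     ∫ x in Set.Ioo (m - s) (m + s), x^k * chebR (x - m) d n * w x := ⟨_, fun _ _ => rfl⟩
  have hGF := uniq F (fun k n => (G k n : ℂ)) (d : ℂ) (m : ℂ) F0 (by
      intro k; simp [hG, chebR]) (by
      intro n
      rw [F1, hG]
      simp only [pow_zero, one_mul, mul_one]
      rw [htot']
      push_cast; rfl) (by
      intro k n
      rw [F2, hd, hm]; push_cast; rfl) (by
      intro k n
      norm_cast
      have := add3 (fun x => x^k * chebR (x - m) d (n+2)) (fun x => x^k * chebR (x - m) d n)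
        (fun x => x^k * chebR (x - m) d (n+1)) w (m-s) (m+s) d m 
        ((continuous_pow k).mul (cheb_cont m d _)) ((continuous_pow k).mul (cheb_cont m d _))
        ((continuous_pow k).mul (cheb_cont m d _)) hwi
      have e : ∫ x in Set.Ioo (m-s) (m+s), (x^k * chebR (x - m) d (n+2) + d * (x^k * chebR (x - m) d n)
         + m * (x^k * chebR (x - m) d (n+1))) * w x = 
         ∫ x in Set.Ioo (m-s) (m+s), x^(k+1) * chebR (x - m) d (n+1) * w x := by
        refine setIntegral_congr_fun measurableSet_Ioo fun x hx => ?_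
        simp only [chebR]; ring
      rw [e] at this
      rw [hG, hG, hG, hG, ← this]
      simp only [chebR]
      ring)
  rw [hGF k 1, hG]
  have hk0 : (0:ℝ)^k = 0 := zero_pow (by omega)
  simp only [hk0, chebR, mul_one, mul_zero, zero_add]
end

section
/- Let A = {a ∈ C([0,1]; M₂(ℂ)) : a(0) and a(1) are diagonal}, with e(t) = [[1,0],[0,0]] and f(t) = [[t, sqrt(t(1-t))],[sqrt(t(1-t)), 1-t]]. Then e and f are projections in A, and for every tracial state τ on A there exist α₁₁, α₁₀, α₀₁, α₀₀ ≥ 0 with Σα_{ij} ≤ 1 and a probability measure μ on (0,1) such that τ(a) = α₁₀a₁(0) + α₀₁a₂(0) + α₁₁a₁(1) + α₀₀a₂(1) + (1 − Σα_{ij})∫₀¹ tr(a(t)) dμ(t), where a(0) = Diag(a₁(0), a₂(0)), a(1) = Diag(a₁(1), a₂(1)) and tr is the normalized trace on M₂(ℂ). -/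
open MeasureTheory unitInterval
open scoped ComplexOrder

noncomputable section

/-- The universal C*-algebra of two projections, realized as the algebra of
continuous `M₂(ℂ)`-valued functions on `[0,1]` that are diagonal at `0` and `1`. -/
def twoProjAlg : Subalgebra ℂ C(unitInterval, Matrix (Fin 2) (Fin 2) ℂ) where
  carrier := {a | a 0 0 1 = 0 ∧ a 0 1 0 = 0 ∧ a 1 0 1 = 0 ∧ a 1 1 0 = 0}
  mul_mem' := by
    rintro a b ⟨ha1, ha2, ha3, ha4⟩ ⟨hb1, hb2, hb3, hb4⟩
    refine ⟨?_, ?_, ?_, ?_⟩ <;>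
      simp only [Set.mem_setOf_eq, ContinuousMap.mul_apply, Matrix.mul_apply,
        Fin.sum_univ_two]
    · rw [ha1, hb1]; ring
    · rw [ha2, hb2]; ring
    · rw [ha3, hb3]; ring
    · rw [ha4, hb4]; ring
  add_mem' := by
    rintro a b ⟨ha1, ha2, ha3, ha4⟩ ⟨hb1, hb2, hb3, hb4⟩
    refine ⟨?_, ?_, ?_, ?_⟩ <;>
      simp only [Set.mem_setOf_eq, ContinuousMap.add_apply, Matrix.add_apply]
    · rw [ha1, hb1, add_zero]
    · rw [ha2, hb2, add_zero]
    · rw [ha3, hb3, add_zero]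
    · rw [ha4, hb4, add_zero]
  algebraMap_mem' := by
    intro r
    refine ⟨?_, ?_, ?_, ?_⟩ <;>
      · show (algebraMap ℂ (Matrix (Fin 2) (Fin 2) ℂ)) r _ _ = 0
        simp [Matrix.algebraMap_matrix_apply]

/-- The first projection generator `e(t) = [[1,0],[0,0]]`. -/
def projE : C(unitInterval, Matrix (Fin 2) (Fin 2) ℂ) :=
  ContinuousMap.const _ !![1, 0; 0, 0]

/-- The second projection generator `f(t) = [[t, √(t(1-t))],[√(t(1-t)), 1-t]]`. -/
def projF : C(unitInterval, Matrix (Fin 2) (Fin 2) ℂ) where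
  toFun t := !![((t : ℝ) : ℂ), ((Real.sqrt (t * (1 - t)) : ℝ) : ℂ);
                ((Real.sqrt (t * (1 - t)) : ℝ) : ℂ), ((1 - (t : ℝ) : ℝ) : ℂ)]
  continuous_toFun := by
    apply continuous_matrix
    intro i j
    fin_cases i <;> fin_cases j <;> simp <;> fun_prop

lemma tp_rep (L : C(unitInterval, ℂ) →ₗ[ℂ] ℂ)
    (hL : ∀ h : C(unitInterval, ℂ), (∀ t, 0 ≤ h t) → (0:ℝ) ≤ (L h).re ∧ (L h).im = 0) :
    ∃ ν : Measure unitInterval, IsFiniteMeasure ν ∧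
      ∀ h : C(unitInterval, ℂ), L h = ∫ t, h t ∂ν := by
  let J : C(unitInterval, ℝ) → C(unitInterval, ℂ) := fun h =>
    ⟨fun t => (h t : ℂ), by fun_prop⟩
  have Jadd : ∀ f g, J (f + g) = J f + J g := by intro f g; ext t; simp [J]
  have Jsmul : ∀ (c : ℝ) f, J (c • f) = (c : ℂ) • J f := by intro c f; ext t; simp [J]
  have Jre : ∀ f, 0 ≤ f → (0:ℝ) ≤ (L (J f)).re ∧ (L (J f)).im = 0 := by
    intro f hf
    apply hL
    intro t
    have := hf t
    simpa [J] using this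
  let Λ0 : CompactlySupportedContinuousMap unitInterval ℝ →ₗ[ℝ] ℝ :=
    { toFun := fun f => (L (J f.toContinuousMap)).re
      map_add' := by
        intro f g
        have : (f + g).toContinuousMap = f.toContinuousMap + g.toContinuousMap := rfl
        rw [this, Jadd, map_add, Complex.add_re]
      map_smul' := by
        intro c f
        have : (c • f).toContinuousMap = c • f.toContinuousMap := rfl
        rw [this, Jsmul, map_smul]
        simp }
  let Λ : CompactlySupportedContinuousMap unitInterval ℝ →ₚ[ℝ] ℝ :=
    PositiveLinearMap.mk₀ Λ0 (by
      intro f hf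
      exact (Jre f.toContinuousMap hf).1)
  refine ⟨RealRMK.rieszMeasure Λ, inferInstance, ?_⟩
  have key : ∀ f : C(unitInterval, ℝ), (L (J f)).re = ∫ t, f t ∂(RealRMK.rieszMeasure Λ) := by
    intro f
    exact (RealRMK.integral_rieszMeasure Λ (CompactlySupportedContinuousMap.continuousMapEquiv f)).symm
  have im0 : ∀ f : C(unitInterval, ℝ), (L (J f)).im = 0 := by
    intro f
    have h1 : (0 : C(unitInterval, ℝ)) ≤ f ⊔ 0 := le_sup_right
    have h2 : (0 : C(unitInterval, ℝ)) ≤ f ⊔ 0 - f := sub_nonneg.2 le_sup_left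
    have h3 : J (f ⊔ 0) = J (f ⊔ 0 - f) + J f := by rw [← Jadd, sub_add_cancel]
    have h4 := (Jre _ h1).2
    rw [h3, map_add, Complex.add_im, (Jre _ h2).2, zero_add] at h4
    exact h4
  have key2 : ∀ f : C(unitInterval, ℝ),
      L (J f) = ((∫ t, f t ∂(RealRMK.rieszMeasure Λ) : ℝ) : ℂ) := by
    intro f
    apply Complex.ext
    · simpa using key f
    · simpa using im0 f
  intro h
  let hr : C(unitInterval, ℝ) := ⟨fun t => (h t).re, by fun_prop⟩
  let hi : C(unitInterval, ℝ) := ⟨fun t => (h t).im, by fun_prop⟩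
  have hh : h = J hr + Complex.I • J hi := by
    ext t
    simp [J, hr, hi, mul_comm Complex.I, Complex.re_add_im]
  have hint : Integrable (fun t => h t) (RealRMK.rieszMeasure Λ) :=
    h.continuous.integrable_of_hasCompactSupport (HasCompactSupport.of_compactSpace _)
  rw [← integral_re_add_im hint]
  conv_lhs => rw [hh, map_add, map_smul, key2, key2]
  simp [hr, hi, mul_comm]

lemma tp_int (ν : Measure unitInterval) [IsFiniteMeasure ν] {h : unitInterval → ℂ}
    (hc : Continuous h) : Integrable h ν :=
  hc.integrable_of_hasCompactSupport (HasCompactSupport.of_compactSpace _)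

/-- the weight `t(1-t)` -/
def tpW (t : unitInterval) : NNReal := Real.toNNReal ((t : ℝ) * (1 - t))

lemma tpW_cont : Continuous tpW := by unfold tpW; fun_prop

lemma tpW_ne {t : unitInterval} (h : t ∈ ({0, 1} : Set unitInterval)ᶜ) : tpW t ≠ 0 := by
  simp only [Set.mem_compl_iff, Set.mem_insert_iff, Set.mem_singleton_iff, not_or] at h
  have h0 : (0:ℝ) < t := lt_of_le_of_ne t.2.1 (fun e => h.1 (Subtype.ext e.symm))
  have h1 : (t:ℝ) < 1 := lt_of_le_of_ne t.2.2 (fun e => h.2 (Subtype.ext e))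
  have : 0 < (t:ℝ) * (1 - t) := mul_pos h0 (by linarith)
  unfold tpW
  exact (Real.toNNReal_pos.2 this).ne'

lemma tp_restrict_eq (ν1 ν2 : Measure unitInterval) [IsFiniteMeasure ν1] [IsFiniteMeasure ν2]
    (h : ∀ k : C(unitInterval, ℂ), ∫ t, (tpW t : ℂ) * (tpW t : ℂ) * k t ∂ν1 = ∫ t, (tpW t : ℂ) * (tpW t : ℂ) * k t ∂ν2) :
    ν1.restrict {0, 1}ᶜ = ν2.restrict {0, 1}ᶜ := by
  let tpW2 : unitInterval → NNReal := fun t => tpW t * tpW t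
  have hm : Measurable tpW2 := (tpW_cont.mul tpW_cont).measurable
  have hS : MeasurableSet ({0, 1} : Set unitInterval)ᶜ := by measurability
  have fin : ∀ ν : Measure unitInterval, IsFiniteMeasure ν →
      IsFiniteMeasure (ν.withDensity (fun t => (tpW2 t : ENNReal))) := by
    intro ν hν
    apply isFiniteMeasure_withDensity (ne_of_lt _)
    calc ∫⁻ t, (tpW2 t : ENNReal) ∂ν ≤ ∫⁻ t, 1 ∂ν := by
          apply lintegral_mono
          intro t
          have : tpW t ≤ 1 := by
            unfold tpW
            rw [Real.toNNReal_le_one]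
            nlinarith [t.2.1, t.2.2]
          have h2 : tpW2 t ≤ 1 := mul_le_one' this this
          show (tpW2 t : ENNReal) ≤ 1
          exact_mod_cast h2
      _ < ⊤ := by simp
  have E : ν1.withDensity (fun t => (tpW2 t : ENNReal)) = ν2.withDensity (fun t => (tpW2 t : ENNReal)) := by
    have := fin ν1 inferInstance
    have := fin ν2 inferInstance
    apply ext_of_forall_integral_eq_of_IsFiniteMeasure
    intro f
    rw [integral_withDensity_eq_integral_smul hm, integral_withDensity_eq_integral_smul hm]
    have := h ⟨fun t => (f t : ℂ), by fun_prop⟩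
    have e : ∀ t, (tpW t : ℂ) * (tpW t : ℂ) * ((f t : ℝ) : ℂ) = ((tpW2 t • f t : ℝ) : ℂ) := by
      intro t; simp [NNReal.smul_def, tpW2]
    simp only [ContinuousMap.coe_mk, e, integral_complex_ofReal] at this
    exact_mod_cast this
  have R : ∀ ν : Measure unitInterval, ν.restrict {0, 1}ᶜ =
      ((ν.withDensity (fun t => (tpW2 t : ENNReal))).restrict {0, 1}ᶜ).withDensity
        (fun t => (tpW2 t : ENNReal)⁻¹) := by
    intro ν
    rw [restrict_withDensity hS, withDensity_inv_same hm.coe_nnreal_ennreal]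
    · rw [ae_restrict_iff' hS]
      filter_upwards with t ht
      exact_mod_cast mul_ne_zero (tpW_ne ht) (tpW_ne ht)
    · filter_upwards with t
      simp
  rw [R ν1, R ν2, E]

lemma tp_split (ν : Measure unitInterval) [IsFiniteMeasure ν] {h : unitInterval → ℂ}
    (hc : Continuous h) :
    ∫ t, h t ∂ν = (ν.real {0} : ℂ) * h 0 + (ν.real {1} : ℂ) * h 1
      + ∫ t, h t ∂(ν.restrict {0, 1}ᶜ) := by
  have hS : MeasurableSet ({0, 1} : Set unitInterval) := by measurability
  rw [← integral_add_compl hS (tp_int ν hc)]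
  congr 1
  have : ({0, 1} : Set unitInterval) = {0} ∪ {1} := rfl
  rw [this, setIntegral_union (by simp) (by measurability) (tp_int ν hc).integrableOn
    (tp_int ν hc).integrableOn, integral_singleton, integral_singleton]
  simp

/-- matrix-valued function from entries -/
def tpMk (p q r s : C(unitInterval, ℂ)) (hq0 : q 0 = 0) (hq1 : q 1 = 0) (hr0 : r 0 = 0)
    (hr1 : r 1 = 0) : twoProjAlg :=
  ⟨⟨fun t => !![p t, q t; r t, s t], by
    apply continuous_matrix
    intro i j
    fin_cases i <;> fin_cases j <;> simp <;> fun_prop⟩,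
    by simpa using hq0, by simpa using hr0, by simpa using hq1, by simpa using hr1⟩

lemma tp_ext {a b : twoProjAlg}
    (h : ∀ t i j, (a : C(unitInterval, Matrix (Fin 2) (Fin 2) ℂ)) t i j =
      (b : C(unitInterval, Matrix (Fin 2) (Fin 2) ℂ)) t i j) : a = b :=
  Subtype.ext (ContinuousMap.ext fun t => Matrix.ext fun i j => h t i j)

lemma tpMk_coe (p q r s : C(unitInterval, ℂ)) (hq0 hq1 hr0 hr1) (t : unitInterval) :
    (tpMk p q r s hq0 hq1 hr0 hr1 : C(unitInterval, Matrix (Fin 2) (Fin 2) ℂ)) t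
      = !![p t, q t; r t, s t] := rfl

lemma tpz (t : unitInterval) : (0 : C(unitInterval, ℂ)) t = 0 := rfl

/-- diagonal embedding -/
def tpD : (C(unitInterval, ℂ) × C(unitInterval, ℂ)) →ₗ[ℂ] twoProjAlg where
  toFun x := tpMk x.1 0 0 x.2 (tpz 0) (tpz 1) (tpz 0) (tpz 1)
  map_add' := by
    intro x y
    apply tp_ext
    intro t i j
    rw [Subalgebra.coe_add, ContinuousMap.add_apply]
    simp only [tpMk_coe]
    fin_cases i <;> fin_cases j <;> simp
  map_smul' := by
    intro c y
    apply tp_ext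
    intro t i j
    rw [RingHom.id_apply, Subalgebra.coe_smul, ContinuousMap.smul_apply]
    simp only [tpMk_coe]
    fin_cases i <;> fin_cases j <;> simp

lemma tpD_coe (x) (t : unitInterval) :
    (tpD x : C(unitInterval, Matrix (Fin 2) (Fin 2) ℂ)) t = !![x.1 t, 0; 0, x.2 t] := rfl

/-- entry of an element -/
def tpEntry (a : twoProjAlg) (i j : Fin 2) : C(unitInterval, ℂ) :=
  ⟨fun t => (a : C(unitInterval, Matrix (Fin 2) (Fin 2) ℂ)) t i j,
    (a : C(unitInterval, Matrix (Fin 2) (Fin 2) ℂ)).continuous.matrix_elem i j⟩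

/-- the weight as a complex function -/
def tpWC : C(unitInterval, ℂ) := ⟨fun t => ((tpW t : ℝ) : ℂ), by
  have := tpW_cont
  fun_prop⟩

lemma tp_proj :
    (projE ∈ twoProjAlg ∧ projF ∈ twoProjAlg ∧
      projE * projE = projE ∧ (∀ t, (projE t).conjTranspose = projE t) ∧
      projF * projF = projF ∧ (∀ t, (projF t).conjTranspose = projF t)) := by
  refine ⟨⟨rfl, rfl, rfl, rfl⟩, ?_, ?_, ?_, ?_, ?_⟩
  · refine ⟨?_, ?_, ?_, ?_⟩ <;> simp [projF]
  · ext t i j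
    fin_cases i <;> fin_cases j <;> simp [projE, Matrix.mul_apply]
  · intro t
    ext i j
    fin_cases i <;> fin_cases j <;> simp [projE]
  · ext t i j
    have h : 0 ≤ (t:ℝ) * (1 - t) := mul_nonneg t.2.1 (by linarith [t.2.2])
    have h2 : (((Real.sqrt (t * (1 - t)) : ℝ) : ℂ)) * ((Real.sqrt (t * (1 - t)) : ℝ) : ℂ)
        = (t:ℂ) * (1 - t) := by
      rw [← Complex.ofReal_mul, Real.mul_self_sqrt h]; simp
    rw [ContinuousMap.mul_apply, Matrix.mul_apply, Fin.sum_univ_two]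
    fin_cases i <;> fin_cases j <;>
      simp only [projF, ContinuousMap.coe_mk, Matrix.of_apply, Matrix.cons_val', Matrix.cons_val_zero,
        Matrix.cons_val_one, Matrix.cons_val_fin_one, Fin.zero_eta, Fin.mk_one, Complex.ofReal_sub,
        Complex.ofReal_one, h2, Fin.isValue] <;> ring
  · intro t
    ext i j
    fin_cases i <;> fin_cases j <;> simp [projF, Complex.conj_ofReal]

lemma tp_offdiag (τ : twoProjAlg →ₗ[ℂ] ℂ) (htr : ∀ a b : twoProjAlg, τ (a * b) = τ (b * a))
    (a : twoProjAlg) : τ a = τ (tpD (tpEntry a 0 0, 0)) + τ (tpD (0, tpEntry a 1 1)) := by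
  obtain ⟨h1, h2, h3, h4⟩ := a.2
  replace h1 : tpEntry a 0 1 0 = 0 := h1
  replace h3 : tpEntry a 0 1 1 = 0 := h3
  replace h2 : tpEntry a 1 0 0 = 0 := h2
  replace h4 : tpEntry a 1 0 1 = 0 := h4
  let q := tpMk 0 (tpEntry a 0 1) 0 0 h1 h3 (tpz 0) (tpz 1)
  let r := tpMk 0 0 (tpEntry a 1 0) 0 (tpz 0) (tpz 1) h2 h4
  let e := tpD (1, 0)
  have dec : a = tpD (tpEntry a 0 0, 0) + tpD (0, tpEntry a 1 1) + q + r := by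
    apply tp_ext
    intro t i j
    simp only [Subalgebra.coe_add, ContinuousMap.add_apply, q, r, tpMk_coe, tpD_coe]
    fin_cases i <;> fin_cases j <;> simp [tpEntry]
  have mulc : ∀ (x y : twoProjAlg) t,
    ((x * y : twoProjAlg) : C(unitInterval, Matrix (Fin 2) (Fin 2) ℂ)) t
      = (x : C(unitInterval, Matrix (Fin 2) (Fin 2) ℂ)) t
        * (y : C(unitInterval, Matrix (Fin 2) (Fin 2) ℂ)) t := fun _ _ _ => rfl
  have q1 : e * q = q := by
    apply tp_ext
    intro t i j
    rw [mulc]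
    simp only [e, q, tpMk_coe, tpD_coe]
    fin_cases i <;> fin_cases j <;> simp
  have q2 : q * e = 0 := by
    apply tp_ext
    intro t i j
    rw [mulc]
    simp only [e, q, tpMk_coe, tpD_coe]
    fin_cases i <;> fin_cases j <;> simp
  have r1 : e * r = 0 := by
    apply tp_ext
    intro t i j
    rw [mulc]
    simp only [e, r, tpMk_coe, tpD_coe]
    fin_cases i <;> fin_cases j <;> simp
  have r2 : r * e = r := by
    apply tp_ext
    intro t i j
    rw [mulc]
    simp only [e, r, tpMk_coe, tpD_coe]
    fin_cases i <;> fin_cases j <;> simp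
  have q3 : τ q = 0 := by rw [← q1, htr, q2, map_zero]
  have r3 : τ r = 0 := by rw [← r2, htr, r1, map_zero]
  conv_lhs => rw [dec, map_add, map_add, map_add, q3, r3]
  ring

lemma tp_swap (τ : twoProjAlg →ₗ[ℂ] ℂ) (htr : ∀ a b : twoProjAlg, τ (a * b) = τ (b * a))
    (k : C(unitInterval, ℂ)) : τ (tpD (tpWC * tpWC * k, 0)) = τ (tpD (0, tpWC * tpWC * k)) := by
  have w0 : tpWC 0 = 0 := by simp [tpWC, tpW]
  have w1 : tpWC 1 = 0 := by simp [tpWC, tpW]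
  let q := tpMk 0 (tpWC * k) 0 0 (by simp [w0]) (by simp [w1]) (tpz 0) (tpz 1)
  let r := tpMk 0 0 tpWC 0 (tpz 0) (tpz 1) w0 w1
  have mulc : ∀ (x y : twoProjAlg) t,
    ((x * y : twoProjAlg) : C(unitInterval, Matrix (Fin 2) (Fin 2) ℂ)) t
      = (x : C(unitInterval, Matrix (Fin 2) (Fin 2) ℂ)) t
        * (y : C(unitInterval, Matrix (Fin 2) (Fin 2) ℂ)) t := fun _ _ _ => rfl
  have e1 : tpD (tpWC * tpWC * k, 0) = q * r := by
    apply tp_ext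
    intro t i j
    rw [mulc]
    simp only [r, q, tpMk_coe, tpD_coe]
    fin_cases i <;> fin_cases j <;> simp
    ring
  have e2 : tpD (0, tpWC * tpWC * k) = r * q := by
    apply tp_ext
    intro t i j
    rw [mulc]
    simp only [r, q, tpMk_coe, tpD_coe]
    fin_cases i <;> fin_cases j <;> simp
    ring
  rw [e1, e2, htr]

set_option synthInstance.maxHeartbeats 1000000 in
/-- Structure theorem for tracial states on the universal C*-algebra of two
projections: `e, f` are projections in `A = twoProjAlg`, and every tracial state
`τ` on `A` has the form
`τ(a) = α₁₀a₁(0) + α₀₁a₂(0) + α₁₁a₁(1) + α₀₀a₂(1) + (1−Σα)·∫₀¹ tr(a(t)) dμ(t)`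
for some `αᵢⱼ ≥ 0` with `Σαᵢⱼ ≤ 1` and a probability measure `μ` on `(0,1)`,
where `tr` is the normalized trace on `M₂(ℂ)`. -/
theorem stmt15 :
    (projE ∈ twoProjAlg ∧ projF ∈ twoProjAlg ∧
      projE * projE = projE ∧ (∀ t, (projE t).conjTranspose = projE t) ∧
      projF * projF = projF ∧ (∀ t, (projF t).conjTranspose = projF t)) ∧
    ∀ τ : twoProjAlg →ₗ[ℂ] ℂ,
      τ 1 = 1 →
      (∀ a b : twoProjAlg, τ (a * b) = τ (b * a)) →
      (∀ a : twoProjAlg,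
        (∀ t, ((a : C(unitInterval, Matrix (Fin 2) (Fin 2) ℂ)) t).PosSemidef) →
        (0:ℝ) ≤ (τ a).re ∧ (τ a).im = 0) →
      ∃ (α11 α10 α01 α00 : ℝ) (μ : Measure unitInterval),
        0 ≤ α11 ∧ 0 ≤ α10 ∧ 0 ≤ α01 ∧ 0 ≤ α00 ∧
        α11 + α10 + α01 + α00 ≤ 1 ∧
        IsProbabilityMeasure μ ∧ μ {0} = 0 ∧ μ {1} = 0 ∧
        ∀ a : twoProjAlg,
          τ a = (α10 : ℂ) * (a : C(unitInterval, Matrix (Fin 2) (Fin 2) ℂ)) 0 0 0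
            + (α01 : ℂ) * (a : C(unitInterval, Matrix (Fin 2) (Fin 2) ℂ)) 0 1 1
            + (α11 : ℂ) * (a : C(unitInterval, Matrix (Fin 2) (Fin 2) ℂ)) 1 0 0
            + (α00 : ℂ) * (a : C(unitInterval, Matrix (Fin 2) (Fin 2) ℂ)) 1 1 1
            + ((1 - (α11 + α10 + α01 + α00) : ℝ) : ℂ) *
                ∫ t, (Matrix.trace
                  ((a : C(unitInterval, Matrix (Fin 2) (Fin 2) ℂ)) t)) / 2 ∂μ := by
  refine ⟨tp_proj, ?_⟩
  intro τ h1 htr hpos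
  obtain ⟨ν1, hf1, hν1⟩ := tp_rep (τ ∘ₗ tpD ∘ₗ LinearMap.inl ℂ _ _) (by
    intro h hh
    apply hpos
    intro t
    have : !![h t, 0; 0, 0] = Matrix.diagonal ![h t, 0] := by
      ext i j; fin_cases i <;> fin_cases j <;> simp
    show (!![h t, 0; 0, 0] : Matrix (Fin 2) (Fin 2) ℂ).PosSemidef
    rw [this]
    apply Matrix.PosSemidef.diagonal
    intro i
    fin_cases i
    · exact hh t
    · exact le_rfl)
  obtain ⟨ν2, hf2, hν2⟩ := tp_rep (τ ∘ₗ tpD ∘ₗ LinearMap.inr ℂ _ _) (by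
    intro h hh
    apply hpos
    intro t
    have : !![0, 0; 0, h t] = Matrix.diagonal ![0, h t] := by
      ext i j; fin_cases i <;> fin_cases j <;> simp
    show (!![0, 0; 0, h t] : Matrix (Fin 2) (Fin 2) ℂ).PosSemidef
    rw [this]
    apply Matrix.PosSemidef.diagonal
    intro i
    fin_cases i
    · exact le_rfl
    · exact hh t)
  replace hν1 : ∀ h, τ (tpD (h, 0)) = ∫ t, h t ∂ν1 := hν1
  replace hν2 : ∀ h, τ (tpD (0, h)) = ∫ t, h t ∂ν2 := hν2
  have hR : ν1.restrict {0, 1}ᶜ = ν2.restrict {0, 1}ᶜ := by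
    apply tp_restrict_eq
    intro k
    have := tp_swap τ htr k
    rw [hν1, hν2] at this
    exact this
  let ν := ν1.restrict {0, 1}ᶜ
  have hτ : ∀ a : twoProjAlg, τ a =
      (ν1.real {0} : ℂ) * tpEntry a 0 0 0 + (ν1.real {1} : ℂ) * tpEntry a 0 0 1
      + (ν2.real {0} : ℂ) * tpEntry a 1 1 0 + (ν2.real {1} : ℂ) * tpEntry a 1 1 1
      + ∫ t, (tpEntry a 0 0 t + tpEntry a 1 1 t) ∂ν := by
    intro a
    rw [tp_offdiag τ htr a, hν1, hν2, tp_split ν1 (tpEntry a 0 0).continuous,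
      tp_split ν2 (tpEntry a 1 1).continuous, ← hR,
      integral_add (tp_int ν (tpEntry a 0 0).continuous) (tp_int ν (tpEntry a 1 1).continuous)]
    ring
  have hsum : 1 - (ν1.real {1} + ν1.real {0} + ν2.real {0} + ν2.real {1}) = 2 * ν.real Set.univ := by
    have h := hτ 1
    rw [h1] at h
    have e0 : ∀ t, tpEntry 1 0 0 t = 1 := fun t => rfl
    have e1 : ∀ t, tpEntry 1 1 1 t = 1 := fun t => rfl
    simp only [e0, e1, integral_const] at h
    have h' : (1:ℝ) = ν1.real {0} * 1 + ν1.real {1} * 1 + ν2.real {0} * 1 + ν2.real {1} * 1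
      + ν.real Set.univ * (1 + 1) := by
      have h2 := congrArg Complex.re h
      simp at h2
      linarith
    linarith
  have hν0 : ν {0} = 0 := by
    show (ν1.restrict {0, 1}ᶜ) {0} = 0
    rw [Measure.restrict_apply (by measurability)]
    simp
  have hν1' : ν {1} = 0 := by
    show (ν1.restrict {0, 1}ᶜ) {1} = 0
    rw [Measure.restrict_apply (by measurability)]
    simp
  have hfin : ∃ μ : Measure unitInterval, IsProbabilityMeasure μ ∧ μ {0} = 0 ∧ μ {1} = 0 ∧
      ∀ g : unitInterval → ℂ, ((ν.real Set.univ : ℝ) : ℂ) * ∫ t, g t ∂μ = ∫ t, g t ∂ν := by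
    by_cases hz : ν = 0
    · refine ⟨volume, inferInstance, ?_, ?_, ?_⟩
      · simp
      · simp
      · intro g
        rw [hz]; simp
    · have : NeZero ν := ⟨hz⟩
      refine ⟨(ν Set.univ)⁻¹ • ν, inferInstance, ?_, ?_, ?_⟩
      · simp [hν0]
      · simp [hν1']
      · intro g
        have hne : ν.real Set.univ ≠ 0 := by simpa [measureReal_eq_zero_iff] using hz
        rw [integral_smul_measure, ENNReal.toReal_inv]
        change _ * ((ν.real Set.univ)⁻¹ • _) = _
        rw [Complex.real_smul, ← mul_assoc, ← Complex.ofReal_mul, mul_inv_cancel₀ hne]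
        simp
  obtain ⟨μ, hμ, hμ0, hμ1, hμg⟩ := hfin
  refine ⟨ν1.real {1}, ν1.real {0}, ν2.real {0}, ν2.real {1}, μ, measureReal_nonneg,
    measureReal_nonneg, measureReal_nonneg, measureReal_nonneg, ?_, hμ, hμ0, hμ1, ?_⟩
  · have : 0 ≤ ν.real Set.univ := measureReal_nonneg
    linarith
  · intro a
    rw [hτ a, ← hμg, hsum]
    simp only [Matrix.trace_fin_two, integral_div]
    simp only [tpEntry, ContinuousMap.coe_mk]
    push_cast
    ring


end
end
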